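/- arXiv:0910.1651 — 4 statements merged into one kernel-verified Lean document; each statement's English description precedes it below -/
import Mathlib

section
/- Let (a_ν)_{ν≥1} be a sequence of nonnegative real numbers and λ > 0 a real number such that for every integer k ≥ 1 one has ∑_{i+j=k, i,j≥1} a_i·a_j ≤ λ·a_k. Then for every integer k ≥ 1, ∑_{n=1}^{k} (1/n!)·∑_{(i₁,…,i_n), i_j≥1, i₁+⋯+i_n=k} a_{i₁}⋯a_{i_n} ≤ ((e^λ − 1)/λ)·a_k ≤ (e^λ/λ)·a_k. In other words, coefficientwise e^{A(t)} − 1 ≺ (1/λ)·e^λ·A(t) for A(t) = ∑_{ν≥1} a_ν t^ν. -/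
/-- The `k`-th coefficient of the `(n+1)`-st power of `∑ b_ν t^ν`, expanded over its first factor. -/
theorem sum_antidiagonalTuple_succ_prod (b : ℕ → ℝ) (n k : ℕ) :
    ∑ f ∈ Finset.Nat.antidiagonalTuple (n + 1) k, ∏ j, b (f j) =
      ∑ p ∈ Finset.HasAntidiagonal.antidiagonal k,
        b p.1 * ∑ f ∈ Finset.Nat.antidiagonalTuple n p.2, ∏ j, b (f j) := by
  simp_rw [Finset.mul_sum]
  rw [Finset.sum_sigma']
  refine Finset.sum_bij' (fun f _ => ⟨(f 0, ∑ j, Fin.tail f j), Fin.tail f⟩)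
    (fun x _ => Fin.cons x.1.1 x.2) ?_ ?_ ?_ ?_ ?_
  · intro f hf
    rw [Finset.Nat.mem_antidiagonalTuple, Fin.sum_univ_succ] at hf
    simpa [Finset.Nat.mem_antidiagonalTuple, Fin.tail] using hf
  · rintro ⟨⟨i, m⟩, g⟩ h
    simp only [Finset.mem_sigma, Finset.HasAntidiagonal.mem_antidiagonal,
      Finset.Nat.mem_antidiagonalTuple] at h
    simp [Finset.Nat.mem_antidiagonalTuple, Fin.sum_univ_succ, h]
  · intro f _
    simp
  · rintro ⟨⟨i, m⟩, g⟩ h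
    simp only [Finset.mem_sigma, Finset.Nat.mem_antidiagonalTuple] at h
    obtain ⟨-, rfl⟩ := h
    simp
  · intro f _
    simp [Fin.prod_univ_succ, Fin.tail]

/-- If `B(t)² ≺ c·B(t)` with nonnegative coefficients, then `B(t)^(n+1) ≺ c^n·B(t)`. -/
theorem sum_antidiagonalTuple_prod_le (b : ℕ → ℝ) (hb : ∀ ν, 0 ≤ b ν) (c : ℝ) (hc : 0 ≤ c)
    (hsq : ∀ k, ∑ p ∈ Finset.HasAntidiagonal.antidiagonal k, b p.1 * b p.2 ≤ c * b k) (n k : ℕ) :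
    ∑ f ∈ Finset.Nat.antidiagonalTuple (n + 1) k, ∏ j, b (f j) ≤ c ^ n * b k := by
  induction n generalizing k with
  | zero => simp
  | succ n ih =>
    rw [sum_antidiagonalTuple_succ_prod]
    calc _ ≤ ∑ p ∈ Finset.HasAntidiagonal.antidiagonal k, b p.1 * (c ^ n * b p.2) :=
          Finset.sum_le_sum fun p _ => mul_le_mul_of_nonneg_left (ih p.2) (hb p.1)
      _ = c ^ n * ∑ p ∈ Finset.HasAntidiagonal.antidiagonal k, b p.1 * b p.2 := by
          rw [Finset.mul_sum]
          exact Finset.sum_congr rfl fun p _ => by ring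
      _ ≤ c ^ n * (c * b k) := mul_le_mul_of_nonneg_left (hsq k) (pow_nonneg hc n)
      _ = c ^ (n + 1) * b k := by ring

theorem sum_antidiagonalTuple_filter_prod (a : ℕ → ℝ) (n k : ℕ) :
    ∑ f ∈ (Finset.Nat.antidiagonalTuple n k).filter (fun f => ∀ j, 1 ≤ f j), ∏ j, a (f j) =
      ∑ f ∈ Finset.Nat.antidiagonalTuple n k, ∏ j, if f j = 0 then 0 else a (f j) := by
  rw [Finset.sum_filter]
  refine Finset.sum_congr rfl fun f _ => ?_
  split_ifs with h
  · exact Finset.prod_congr rfl fun j _ => (if_neg (Nat.one_le_iff_ne_zero.mp (h j))).symm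
  · push Not at h
    obtain ⟨j, hj⟩ := h
    symm
    exact Finset.prod_eq_zero (Finset.mem_univ j) (if_pos (Nat.lt_one_iff.mp hj))

theorem sum_antidiagonal_truncated_mul (a : ℕ → ℝ) (k : ℕ) :
    ∑ p ∈ Finset.HasAntidiagonal.antidiagonal k,
        (if p.1 = 0 then 0 else a p.1) * (if p.2 = 0 then 0 else a p.2) =
      ∑ i ∈ Finset.Ico 1 k, a i * a (k - i) := by
  rw [Finset.Nat.sum_antidiagonal_eq_sum_range_succ_mk]
  symm
  refine Finset.sum_subset_zero_on_sdiff (fun i hi => ?_) (fun i hi => ?_) (fun i hi => ?_)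
  · simp only [Finset.mem_Ico, Finset.mem_range] at *
    omega
  · simp only [Finset.mem_sdiff, Finset.mem_Ico, Finset.mem_range] at hi
    obtain rfl | rfl : i = 0 ∨ i = k := by omega
    · simp
    · simp
  · rw [Finset.mem_Ico] at hi
    rw [if_neg (by omega), if_neg (by omega)]

theorem sum_Icc_pow_pred_div_factorial_le (c : ℝ) (hc : 0 < c) (k : ℕ) :
    ∑ n ∈ Finset.Icc 1 k, 1 / (n.factorial : ℝ) * c ^ (n - 1) ≤ (Real.exp c - 1) / c := by
  rw [le_div_iff₀ hc, Finset.sum_mul, le_sub_iff_add_le]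
  refine le_trans (le_of_eq ?_) (Real.sum_le_exp_of_nonneg hc.le (k + 1))
  rw [Finset.sum_range_succ', ← Finset.Ico_add_one_right_eq_Icc, Finset.sum_Ico_eq_sum_range]
  simp only [Nat.add_sub_cancel, pow_zero, Nat.factorial_zero, Nat.cast_one, div_one]
  congr 1
  refine Finset.sum_congr rfl fun n _ => ?_
  rw [Nat.add_comm 1 n, Nat.add_sub_cancel, pow_succ]
  ring

/-- If `(a_ν)_{ν≥1}` are nonnegative reals with `∑_{i+j=k, i,j≥1} a_i·a_j ≤ λ·a_k` for all
`k ≥ 1`, then for every `k ≥ 1`,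
`∑_{n=1}^{k} (1/n!)·(k-th coefficient of A(t)^n) ≤ ((e^λ − 1)/λ)·a_k ≤ (e^λ/λ)·a_k`;
coefficientwise `e^{A(t)} − 1 ≺ (1/λ)·e^λ·A(t)`. -/
theorem exp_coeff_le (a : ℕ → ℝ) (ha : ∀ ν, 0 ≤ a ν) (lam : ℝ) (hlam : 0 < lam)
    (hsq : ∀ k : ℕ, 1 ≤ k → ∑ i ∈ Finset.Ico 1 k, a i * a (k - i) ≤ lam * a k) :
    ∀ k : ℕ, 1 ≤ k →
      ∑ n ∈ Finset.Icc 1 k, (1 / (n.factorial : ℝ)) *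
          ∑ f ∈ (Finset.Nat.antidiagonalTuple n k).filter (fun f => ∀ j, 1 ≤ f j),
            ∏ j, a (f j)
        ≤ (Real.exp lam - 1) / lam * a k ∧
      (Real.exp lam - 1) / lam * a k ≤ Real.exp lam / lam * a k := by
  intro k hk
  have hsq' : ∀ m, ∑ p ∈ Finset.HasAntidiagonal.antidiagonal m,
      (if p.1 = 0 then 0 else a p.1) * (if p.2 = 0 then 0 else a p.2) ≤
        lam * if m = 0 then 0 else a m := by
    intro m
    rw [sum_antidiagonal_truncated_mul]
    rcases Nat.eq_zero_or_pos m with rfl | hm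
    · simp
    · rw [if_neg hm.ne']
      exact hsq m hm
  refine ⟨?_, ?_⟩
  · refine le_trans ?_ (mul_le_mul_of_nonneg_right
      (sum_Icc_pow_pred_div_factorial_le lam hlam k) (ha k))
    rw [Finset.sum_mul]
    refine Finset.sum_le_sum fun n hn => ?_
    obtain ⟨m, rfl⟩ := Nat.exists_eq_add_of_le' (Finset.mem_Icc.mp hn).1
    rw [sum_antidiagonalTuple_filter_prod, mul_assoc]
    refine mul_le_mul_of_nonneg_left ?_ (by positivity)
    have h := sum_antidiagonalTuple_prod_le (fun ν => if ν = 0 then 0 else a ν)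
      (fun ν => ite_nonneg le_rfl (ha ν)) lam hlam.le hsq' m k
    simpa [Nat.one_le_iff_ne_zero.mp hk] using h
  · refine mul_le_mul_of_nonneg_right ?_ (ha k)
    gcongr
    linarith
end

section
/- Let c > 0 and C₁ > 0 be real numbers with C₁ ≤ c, and set M_ν = c^{ν−1}/(16·ν²) for ν ≥ 1. Suppose (x_k)_{k≥1} is a sequence of nonnegative real numbers such that x₁ ≤ M₁ = 1/16 and, for every k ≥ 2, x_k ≤ C₁·∑_{i=1}^{k−1} x_i·x_{k−i}. Then x_k ≤ M_k for every k ≥ 1, and consequently the series ∑_{k≥1} x_k·t^k converges for every real t with 0 ≤ t ≤ 1/c. -/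
theorem one_div_sq_mul_sq_le {a b : ℝ} (ha : 0 < a) (hb : 0 < b) :
    1 / (a ^ 2 * b ^ 2) ≤ 2 / (a + b) ^ 2 * ((a ^ 2)⁻¹ + (b ^ 2)⁻¹) := by
  have h : 2 / (a + b) ^ 2 * ((a ^ 2)⁻¹ + (b ^ 2)⁻¹) - 1 / (a ^ 2 * b ^ 2) =
      (a - b) ^ 2 / ((a + b) ^ 2 * a ^ 2 * b ^ 2) := by
    field_simp
    ring
  have : 0 ≤ (a - b) ^ 2 / ((a + b) ^ 2 * a ^ 2 * b ^ 2) := by positivity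
  linarith

theorem sum_Ico_one_inv_sq_le (k : ℕ) : ∑ i ∈ Finset.Ico 1 k, ((i : ℝ) ^ 2)⁻¹ ≤ 2 := by
  have h := sum_Ioo_inv_sq_le (α := ℝ) 0 k
  norm_num at h
  exact h

/-- The convolution square of `1 / i ^ 2` is dominated by a multiple of `1 / k ^ 2`. -/
theorem sum_Ico_one_div_sq_mul_sq_le (k : ℕ) :
    ∑ i ∈ Finset.Ico 1 k, 1 / ((i : ℝ) ^ 2 * ((k - i : ℕ) : ℝ) ^ 2) ≤ 16 / (k : ℝ) ^ 2 := by
  have hreflect : ∑ i ∈ Finset.Ico 1 k, (((k - i : ℕ) : ℝ) ^ 2)⁻¹ =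
      ∑ i ∈ Finset.Ico 1 k, ((i : ℝ) ^ 2)⁻¹ := by
    simpa using Finset.sum_Ico_reflect (fun i : ℕ => ((i : ℝ) ^ 2)⁻¹) 1 (Nat.le_succ k)
  calc ∑ i ∈ Finset.Ico 1 k, 1 / ((i : ℝ) ^ 2 * ((k - i : ℕ) : ℝ) ^ 2)
      ≤ ∑ i ∈ Finset.Ico 1 k,
          2 / (k : ℝ) ^ 2 * (((i : ℝ) ^ 2)⁻¹ + (((k - i : ℕ) : ℝ) ^ 2)⁻¹) := by
        refine Finset.sum_le_sum fun i hi => ?_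
        obtain ⟨h1, h2⟩ := Finset.mem_Ico.1 hi
        have hk : (k : ℝ) = (i : ℝ) + ((k - i : ℕ) : ℝ) := by
          rw [Nat.cast_sub h2.le]
          ring
        rw [hk]
        exact one_div_sq_mul_sq_le (by exact_mod_cast h1)
          (by exact_mod_cast Nat.sub_pos_of_lt h2)
    _ = 2 / (k : ℝ) ^ 2 * (2 * ∑ i ∈ Finset.Ico 1 k, ((i : ℝ) ^ 2)⁻¹) := by
        rw [← Finset.mul_sum, Finset.sum_add_distrib, hreflect, two_mul]
    _ ≤ 2 / (k : ℝ) ^ 2 * (2 * 2) := by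
        gcongr
        exact sum_Ico_one_inv_sq_le k
    _ ≤ 16 / (k : ℝ) ^ 2 := by
        rw [div_mul_eq_mul_div]
        gcongr
        norm_num


/-- Majorant-method lemma: if `0 < C₁ ≤ c`, `M_ν = c^{ν-1}/(16ν²)`, and a nonnegative
sequence `(x_k)` satisfies `x₁ ≤ 1/16` and `x_k ≤ C₁·∑_{i=1}^{k-1} x_i·x_{k-i}` for `k ≥ 2`,
then `x_k ≤ M_k` for all `k ≥ 1` and `∑_{k≥1} x_k t^k` converges for all `0 ≤ t ≤ 1/c`. -/
theorem majorant_method (c C₁ : ℝ) (hc : 0 < c) (hC₁ : 0 < C₁) (hC₁c : C₁ ≤ c)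
    (x : ℕ → ℝ) (hx : ∀ k, 0 ≤ x k) (hx1 : x 1 ≤ 1 / 16)
    (hrec : ∀ k : ℕ, 2 ≤ k → x k ≤ C₁ * ∑ i ∈ Finset.Ico 1 k, x i * x (k - i)) :
    (∀ k : ℕ, 1 ≤ k → x k ≤ c ^ (k - 1) / (16 * (k : ℝ) ^ 2)) ∧
    (∀ t : ℝ, 0 ≤ t → t ≤ 1 / c → Summable (fun k : ℕ => x (k + 1) * t ^ (k + 1))) := by
  have hM : ∀ k : ℕ, 1 ≤ k → x k ≤ c ^ (k - 1) / (16 * (k : ℝ) ^ 2) := by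
    intro k
    induction k using Nat.strong_induction_on with
    | _ k ih =>
      intro hk
      rcases hk.eq_or_lt with rfl | hk2
      · simpa using hx1
      calc x k ≤ C₁ * ∑ i ∈ Finset.Ico 1 k, x i * x (k - i) := hrec k hk2
        _ ≤ c * ∑ i ∈ Finset.Ico 1 k,
              c ^ (k - 2) / 256 * (1 / ((i : ℝ) ^ 2 * ((k - i : ℕ) : ℝ) ^ 2)) := by
            refine mul_le_mul hC₁c (Finset.sum_le_sum fun i hi => ?_)
              (Finset.sum_nonneg fun i _ => mul_nonneg (hx _) (hx _)) hc.le
            obtain ⟨h1, h2⟩ := Finset.mem_Ico.1 hi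
            calc x i * x (k - i)
                ≤ c ^ (i - 1) / (16 * (i : ℝ) ^ 2) *
                    (c ^ (k - i - 1) / (16 * ((k - i : ℕ) : ℝ) ^ 2)) :=
                  mul_le_mul (ih i h2 h1) (ih (k - i) (by omega) (by omega)) (hx _)
                    (by positivity)
              _ = c ^ (k - 2) / 256 * (1 / ((i : ℝ) ^ 2 * ((k - i : ℕ) : ℝ) ^ 2)) := by
                  rw [show k - 2 = (i - 1) + (k - i - 1) by omega, pow_add, div_mul_div_comm,
                    div_mul_div_comm]
                  congr 1 <;> ring
        _ ≤ c * (c ^ (k - 2) / 256 * (16 / (k : ℝ) ^ 2)) := by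
            rw [← Finset.mul_sum]
            gcongr
            exact sum_Ico_one_div_sq_mul_sq_le k
        _ = c ^ (k - 1) / (16 * (k : ℝ) ^ 2) := by
            rw [show k - 1 = (k - 2) + 1 by omega]
            field_simp
            ring
  refine ⟨hM, fun t ht0 ht => ?_⟩
  have hsum : Summable fun k : ℕ => 1 / (16 * c) * (1 / ((k + 1 : ℕ) : ℝ) ^ 2) :=
    ((summable_nat_add_iff 1).2 (Real.summable_one_div_nat_pow.2 one_lt_two)).mul_left _
  refine hsum.of_nonneg_of_le (fun k => mul_nonneg (hx _) (pow_nonneg ht0 _)) fun k => ?_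
  calc x (k + 1) * t ^ (k + 1)
      ≤ c ^ k / (16 * ((k + 1 : ℕ) : ℝ) ^ 2) * (1 / c) ^ (k + 1) := by
        gcongr
        simpa using hM (k + 1) (Nat.le_add_left 1 k)
    _ = 1 / (16 * c) * (1 / ((k + 1 : ℕ) : ℝ) ^ 2) := by
        rw [one_div, inv_pow]
        field_simp
        ring
end

section
/- Let R be a (not necessarily commutative) ring, let d, a, b ∈ R and m, n ∈ ℕ, and assume a and b graded-commute: a·b = (−1)^{m·n}·b·a. Set Da = d·a − (−1)^m·a·d and Db = d·b − (−1)^n·b·d (the graded commutators with d, where d is treated as odd and a, b have degrees m, n). Then [Da, b]_{m+1,n} = (−1)^{m·n}·[Db, a]_{n+1,m}; explicitly, Da·b − (−1)^{(m+1)·n}·b·Da = (−1)^{m·n}·(Db·a − (−1)^{(n+1)·m}·a·Db). -/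
/-- If `a` and `b` graded-commute, `a·b = (−1)^{m·n}·b·a`, then with
`Da = d·a − (−1)^m·a·d` and `Db = d·b − (−1)^n·b·d` one has
`[Da, b]_{m+1,n} = (−1)^{m·n}·[Db, a]_{n+1,m}`. -/
theorem gradedComm_derived_symm {R : Type*} [Ring R] (d a b : R) (m n : ℕ)
    (hab : a * b = (-1 : R) ^ (m * n) * b * a) :
    (d * a - (-1 : R) ^ m * a * d) * b -
        (-1 : R) ^ ((m + 1) * n) * b * (d * a - (-1 : R) ^ m * a * d) =
      (-1 : R) ^ (m * n) *
        ((d * b - (-1 : R) ^ n * b * d) * a -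
          (-1 : R) ^ ((n + 1) * m) * a * (d * b - (-1 : R) ^ n * b * d)) := by
  have hd : ∀ x : R, a * (b * x) = (-1 : R) ^ (m * n) * b * a * x := fun x => by
    rw [← mul_assoc, hab]
  rw [add_mul, add_mul, one_mul, one_mul, pow_add, pow_add, mul_comm n m]
  rw [pow_mul] at hab hd ⊢
  rcases neg_one_pow_eq_or R m with hm | hm <;>
    rcases neg_one_pow_eq_or R n with hn | hn <;>
    simp only [hm, hn, one_pow, one_mul, neg_mul, mul_neg, neg_neg, mul_assoc, mul_sub, sub_mul,
      mul_add, add_mul, sub_neg_eq_add] at hab hd ⊢ <;>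
    simp only [hab, hd, mul_neg] <;>
    abel
end

section
/- Let V₂, V₃, V₄ be real vector spaces equipped with: linear maps d₂ : V₂ → V₃ and d₃ : V₃ → V₄; a symmetric bilinear map [·,·] : V₂ × V₂ → V₃; and a bilinear map [·,·]' : V₃ × V₂ → V₄, satisfying the Leibniz rule d₃([x,y]) = [d₂x, y]' + [d₂y, x]' for all x, y ∈ V₂ and the Jacobi identity [[x,y], z]' + [[y,z], x]' + [[z,x], y]' = 0 for all x, y, z ∈ V₂. Let k ≥ 2 be an integer and suppose η₁, …, η_{k−1} ∈ V₂ satisfy the truncated Maurer–Cartan equations d₂η_i + (1/2)·∑_{l+m=i, l,m≥1} [η_l, η_m] = 0 for every 1 ≤ i ≤ k−1. Then the k-th obstruction is closed: d₃( ∑_{i+j=k, i,j≥1} [η_i, η_j] ) = 0. -/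
/-- A sum over the compositions `a + b + c = k` into positive parts is invariant under the
cyclic permutation of the parts. -/
theorem sum_compositions_three_rotate {M : Type*} [AddCommMonoid M] (k : ℕ)
    (F : ℕ → ℕ → ℕ → M) :
    ∑ i ∈ Finset.Ico 1 k, ∑ l ∈ Finset.Ico 1 i, F l (i - l) (k - i) =
      ∑ i ∈ Finset.Ico 1 k, ∑ l ∈ Finset.Ico 1 i, F (i - l) (k - i) l := by
  rw [Finset.sum_sigma', Finset.sum_sigma']
  refine Finset.sum_bij' (fun p _ => ⟨k - p.1 + p.2, k - p.1⟩)
    (fun p _ => ⟨k - p.2, p.1 - p.2⟩) ?_ ?_ ?_ ?_ ?_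
  all_goals
    rintro ⟨i, l⟩ h
    simp only [Finset.mem_sigma, Finset.mem_Ico] at h
  · simp only [Finset.mem_sigma, Finset.mem_Ico]
    omega
  · simp only [Finset.mem_sigma, Finset.mem_Ico]
    omega
  · simp only [Sigma.mk.injEq, heq_eq_eq]
    omega
  · simp only [Sigma.mk.injEq, heq_eq_eq]
    omega
  · dsimp only
    congr 1 <;> omega

/-- If the cyclic sums of `F` vanish, then so does its sum over the compositions
`a + b + c = k` into positive parts, up to 3-torsion. -/
theorem three_nsmul_sum_compositions_three_eq_zero {M : Type*} [AddCommMonoid M] (k : ℕ)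
    (F : ℕ → ℕ → ℕ → M) (hF : ∀ a b c, F a b c + F b c a + F c a b = 0) :
    3 • ∑ i ∈ Finset.Ico 1 k, ∑ l ∈ Finset.Ico 1 i, F l (i - l) (k - i) = 0 := by
  have h₁ := sum_compositions_three_rotate k F
  have h₂ := sum_compositions_three_rotate k fun a b c => F b c a
  rw [succ_nsmul, two_nsmul]
  nth_rewrite 3 [h₁.trans h₂]
  nth_rewrite 2 [h₁]
  simp only [← Finset.sum_add_distrib, hF, Finset.sum_const_zero]


/-- If `η₁, …, η_{k−1}` solve the truncated Maurer–Cartan equations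
`d₂η_i + (1/2)·∑_{l+m=i, l,m≥1} [η_l, η_m] = 0` for `1 ≤ i ≤ k−1`, where the symmetric
bracket satisfies the Leibniz rule and the Jacobi identity, then the `k`-th obstruction
`∑_{i+j=k, i,j≥1} [η_i, η_j]` is `d₃`-closed. -/
theorem obstruction_closed (V₂ V₃ V₄ : Type*)
    [AddCommGroup V₂] [Module ℝ V₂] [AddCommGroup V₃] [Module ℝ V₃]
    [AddCommGroup V₄] [Module ℝ V₄]
    (d₂ : V₂ →ₗ[ℝ] V₃) (d₃ : V₃ →ₗ[ℝ] V₄)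
    (br : V₂ →ₗ[ℝ] V₂ →ₗ[ℝ] V₃) (br' : V₃ →ₗ[ℝ] V₂ →ₗ[ℝ] V₄)
    (hsymm : ∀ x y : V₂, br x y = br y x)
    (hleib : ∀ x y : V₂, d₃ (br x y) = br' (d₂ x) y + br' (d₂ y) x)
    (hjac : ∀ x y z : V₂, br' (br x y) z + br' (br y z) x + br' (br z x) y = 0)
    (k : ℕ) (hk : 2 ≤ k) (η : ℕ → V₂)
    (hMC : ∀ i : ℕ, 1 ≤ i → i ≤ k - 1 →
      d₂ (η i) + (1 / 2 : ℝ) • ∑ l ∈ Finset.Ico 1 i, br (η l) (η (i - l)) = 0) :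
    d₃ (∑ i ∈ Finset.Ico 1 k, br (η i) (η (k - i))) = 0 := by
  have hd : ∀ i ∈ Finset.Ico 1 k,
      d₂ (η i) = -((1 / 2 : ℝ) • ∑ l ∈ Finset.Ico 1 i, br (η l) (η (i - l))) := by
    intro i hi
    rw [Finset.mem_Ico] at hi
    exact eq_neg_of_add_eq_zero_left (hMC i hi.1 (by omega))
  have hreflect : ∑ i ∈ Finset.Ico 1 k, br' (d₂ (η (k - i))) (η i) =
      ∑ i ∈ Finset.Ico 1 k, br' (d₂ (η i)) (η (k - i)) := by
    refine Finset.sum_bij' (fun i _ => k - i) (fun i _ => k - i) ?_ ?_ ?_ ?_ ?_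
    all_goals
      intro i hi
      rw [Finset.mem_Ico] at hi
    · rw [Finset.mem_Ico]
      omega
    · rw [Finset.mem_Ico]
      omega
    · omega
    · omega
    · rw [Nat.sub_sub_self hi.2.le]
  have hcyclic : ∑ i ∈ Finset.Ico 1 k, ∑ l ∈ Finset.Ico 1 i,
      br' (br (η l) (η (i - l))) (η (k - i)) = 0 := by
    have h := three_nsmul_sum_compositions_three_eq_zero k
      (fun a b c => br' (br (η a) (η b)) (η c)) fun a b c => hjac (η a) (η b) (η c)
    rw [← Nat.cast_smul_eq_nsmul ℝ] at h
    exact (smul_eq_zero.mp h).resolve_left (by norm_num)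
  have hhalf : ∑ i ∈ Finset.Ico 1 k, br' (d₂ (η i)) (η (k - i)) = 0 := by
    rw [Finset.sum_congr rfl fun i hi => by rw [hd i hi]]
    simp only [map_neg, map_smul, map_sum, LinearMap.neg_apply, LinearMap.smul_apply,
      LinearMap.sum_apply, Finset.sum_neg_distrib, ← Finset.smul_sum, hcyclic, smul_zero,
      neg_zero]
  simp only [map_sum, hleib, Finset.sum_add_distrib, hreflect, hhalf, add_zero]
end
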